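/- Let p ∈ (1,∞). Suppose there is a finite constant C such that Λ(f,g) ≤ C ‖f‖_{L^p(σ;ℓ²)} ‖g‖_{L^{p'}(ω)} for all nonnegative σ×η-measurable f and nonnegative Borel g. Then for every Q ∈ 𝒟 with λ_Q > 0, σ(Q) > 0 and ω(Q) > 0, one has ‖1_{Q̂} μ‖_{L^{p'}(σ;ℓ²)} < ∞. -/

import Mathlib

open MeasureTheory ENNReal Set
open scoped Classical NNReal ENNReal

noncomputable section

/-- The index of a dyadic cube `2^{-k}([0,1)^n + m)` of the standard dyadic lattice `𝒟`. -/
abbrev CubeIdx (n : ℕ) := ℤ × (Fin n → ℤ)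

/-- The dyadic cube `2^{-k}([0,1)^n + m)`. -/
def dyadicCube (n : ℕ) (k : ℤ) (m : Fin n → ℤ) : Set (Fin n → ℝ) :=
  {x | ∀ i, x i ∈ Set.Ico ((2:ℝ) ^ (-k) * (m i : ℝ)) ((2:ℝ) ^ (-k) * ((m i : ℝ) + 1))}

/-- The dyadic cube associated to an index. -/
def idxCube (n : ℕ) (Q : CubeIdx n) : Set (Fin n → ℝ) := dyadicCube n Q.1 Q.2

/-- The Carleson box `Q̂ = Q × (0, ℓ(Q)]`, where `ℓ(Q) = 2^{-k}`. -/
def carlesonBox (n : ℕ) (k : ℤ) (m : Fin n → ℤ) : Set ((Fin n → ℝ) × ℝ) :=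
  (dyadicCube n k m) ×ˢ (Set.Ioc (0:ℝ) ((2:ℝ) ^ (-k)))

/-- The vertical `ℓ²`-norm `|f|_{ℓ²}(x) = (∑_{k ∈ ℤ} f(x, 2^{-k})²)^{1/2}`. -/
def vertL2 (n : ℕ) (f : (Fin n → ℝ) × ℝ → ℝ≥0∞) (x : Fin n → ℝ) : ℝ≥0∞ :=
  (∑' k : ℤ, (f (x, (2:ℝ) ^ (-k))) ^ 2) ^ (1/2 : ℝ)

/-- The mixed norm `‖f‖_{L^q(σ; ℓ²)} = (∫ |f|_{ℓ²}^q dσ)^{1/q}`. -/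
def mixedNorm (n : ℕ) (σ : Measure (Fin n → ℝ)) (q : ℝ)
    (f : (Fin n → ℝ) × ℝ → ℝ≥0∞) : ℝ≥0∞ :=
  (∫⁻ x, (vertL2 n f x) ^ q ∂σ) ^ (1/q)

/-- The norm `‖g‖_{L^q(ω)} = (∫ g^q dω)^{1/q}` of a nonnegative function. -/
def lpNorm (n : ℕ) (ω : Measure (Fin n → ℝ)) (q : ℝ) (g : (Fin n → ℝ) → ℝ≥0∞) : ℝ≥0∞ :=
  (∫⁻ x, (g x) ^ q ∂ω) ^ (1/q)

/-- `∬_{Q̂} f μ dη dσ = ∑_{j ∈ ℤ, 2^j ≤ ℓ(Q)} ∫_Q f(x, 2^j) μ(x, 2^j) dσ(x)`. -/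
def boxInt (n : ℕ) (σ : Measure (Fin n → ℝ)) (μ : (Fin n → ℝ) × ℝ → ℝ≥0∞)
    (f : (Fin n → ℝ) × ℝ → ℝ≥0∞) (k : ℤ) (m : Fin n → ℤ) : ℝ≥0∞ :=
  ∑' j : ℤ, if (2:ℝ) ^ j ≤ (2:ℝ) ^ (-k) then
      ∫⁻ x in dyadicCube n k m, f (x, (2:ℝ) ^ j) * μ (x, (2:ℝ) ^ j) ∂σ
    else 0

/-- `1_{Q̂} μ`. -/
def boxFn (n : ℕ) (μ : (Fin n → ℝ) × ℝ → ℝ≥0∞) (k : ℤ) (m : Fin n → ℤ) :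
    (Fin n → ℝ) × ℝ → ℝ≥0∞ :=
  (carlesonBox n k m).indicator μ

/-- The test function `φ_Q = |1_{Q̂} μ|_{ℓ²}^{p'-2} 1_{Q̂} μ`,
interpreted as `0` where `|1_{Q̂} μ|_{ℓ²} = 0`. -/
def testFn (n : ℕ) (p' : ℝ) (μ : (Fin n → ℝ) × ℝ → ℝ≥0∞) (k : ℤ) (m : Fin n → ℤ) :
    (Fin n → ℝ) × ℝ → ℝ≥0∞ :=
  fun z => if vertL2 n (boxFn n μ k m) z.1 = 0 then 0
    else (vertL2 n (boxFn n μ k m) z.1) ^ (p' - 2) * boxFn n μ k m z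

/-- The bilinear form `Λ(f,g) = ∑_{Q ∈ 𝒟} λ_Q (∬_{Q̂} f μ dη dσ) (∫_Q g dω)`. -/
def lambdaForm (n : ℕ) (σ ω : Measure (Fin n → ℝ)) (μ : (Fin n → ℝ) × ℝ → ℝ≥0∞)
    (lam : CubeIdx n → ℝ≥0) (f : (Fin n → ℝ) × ℝ → ℝ≥0∞) (g : (Fin n → ℝ) → ℝ≥0∞) :
    ℝ≥0∞ :=
  ∑' Q : CubeIdx n,
    (lam Q : ℝ≥0∞) * boxInt n σ μ f Q.1 Q.2 * ∫⁻ x in idxCube n Q, g x ∂ω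

/-- The localized bilinear form `Λ_{Q₀}(f,g)`, where the sum is restricted to
dyadic cubes `Q ⊆ Q₀`. -/
def lambdaLoc (n : ℕ) (σ ω : Measure (Fin n → ℝ)) (μ : (Fin n → ℝ) × ℝ → ℝ≥0∞)
    (lam : CubeIdx n → ℝ≥0) (Q₀ : CubeIdx n)
    (f : (Fin n → ℝ) × ℝ → ℝ≥0∞) (g : (Fin n → ℝ) → ℝ≥0∞) : ℝ≥0∞ :=
  ∑' Q : CubeIdx n, if idxCube n Q ⊆ idxCube n Q₀ then
      (lam Q : ℝ≥0∞) * boxInt n σ μ f Q.1 Q.2 * ∫⁻ x in idxCube n Q, g x ∂ω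
    else 0

/-- The average `⟨h⟩_Q^ν = ν(Q)⁻¹ ∫_Q h dν`, understood as `0` when `ν(Q) = 0`. -/
def cubeAvg (n : ℕ) (ν : Measure (Fin n → ℝ)) (h : (Fin n → ℝ) → ℝ≥0∞)
    (k : ℤ) (m : Fin n → ℤ) : ℝ≥0∞ :=
  (∫⁻ x in dyadicCube n k m, h x ∂ν) / ν (dyadicCube n k m)


lemma measurableSet_dyadicCube (n : ℕ) (k : ℤ) (m : Fin n → ℤ) :
    MeasurableSet (dyadicCube n k m) := by
  have : dyadicCube n k m = Set.pi univ
      (fun i => Set.Ico ((2:ℝ) ^ (-k) * (m i : ℝ)) ((2:ℝ) ^ (-k) * ((m i : ℝ) + 1))) := by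
    ext x; simp [dyadicCube]
  rw [this]
  exact MeasurableSet.univ_pi fun i => measurableSet_Ico

lemma measure_dyadicCube_lt_top (n : ℕ) (ν : Measure (Fin n → ℝ)) [IsLocallyFiniteMeasure ν]
    (k : ℤ) (m : Fin n → ℤ) : ν (dyadicCube n k m) < ∞ := by
  refine lt_of_le_of_lt (measure_mono ?_) (isCompact_Icc (α := Fin n → ℝ)
    (a := fun i => (2:ℝ) ^ (-k) * (m i : ℝ))
    (b := fun i => (2:ℝ) ^ (-k) * ((m i : ℝ) + 1))).measure_lt_top
  exact fun x hx => ⟨fun i => (hx i).1, fun i => (hx i).2.le⟩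

lemma measurable_vertL2 {n : ℕ} {f : (Fin n → ℝ) × ℝ → ℝ≥0∞} (hf : Measurable f) :
    Measurable (vertL2 n f) := by
  unfold vertL2
  refine Measurable.pow_const (Measurable.tsum fun k => Measurable.pow_const ?_ 2) _
  exact hf.comp (measurable_id.prodMk measurable_const)

lemma vertL2_sq (n : ℕ) (f : (Fin n → ℝ) × ℝ → ℝ≥0∞) (x : Fin n → ℝ) :
    vertL2 n f x ^ 2 = ∑' k : ℤ, f (x, (2:ℝ) ^ (-k)) ^ 2 := by
  rw [vertL2, ← ENNReal.rpow_natCast, ← ENNReal.rpow_mul]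
  norm_num

/-- The vertical norm is homogeneous with respect to multipliers depending on `x` only. -/
lemma vertL2_mul (n : ℕ) (c : (Fin n → ℝ) → ℝ≥0∞) (f : (Fin n → ℝ) × ℝ → ℝ≥0∞)
    (x : Fin n → ℝ) : vertL2 n (fun z => c z.1 * f z) x = c x * vertL2 n f x := by
  simp only [vertL2, mul_pow, ENNReal.tsum_mul_left]
  rw [ENNReal.mul_rpow_of_nonneg _ _ (by norm_num), ← ENNReal.rpow_natCast, ← ENNReal.rpow_mul]
  norm_num

/-- Pairing with `f` over the box dominates the full pairing with any `h ≤ 1_{Q̂} μ`. -/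
lemma lintegral_tsum_le_boxInt {n : ℕ} (σ : Measure (Fin n → ℝ))
    {μ f h : (Fin n → ℝ) × ℝ → ℝ≥0∞} (hf : Measurable f) (hh : Measurable h)
    {k : ℤ} {m : Fin n → ℤ} (hle : h ≤ boxFn n μ k m) :
    ∫⁻ x, ∑' j : ℤ, f (x, (2:ℝ) ^ (-j)) * h (x, (2:ℝ) ^ (-j)) ∂σ ≤ boxInt n σ μ f k m := by
  have hslice : ∀ t : ℝ, Measurable fun x : Fin n → ℝ => (x, t) :=
    fun t => measurable_id.prodMk measurable_const
  have hmeas : ∀ j : ℤ, AEMeasurable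
      (fun x => f (x, (2:ℝ) ^ (-j)) * h (x, (2:ℝ) ^ (-j))) σ :=
    fun j => ((hf.comp (hslice _)).mul (hh.comp (hslice _))).aemeasurable
  rw [lintegral_tsum hmeas, boxInt, ← (Equiv.neg ℤ).tsum_eq fun j : ℤ => if (2:ℝ) ^ j ≤ (2:ℝ) ^ (-k) then
      ∫⁻ x in dyadicCube n k m, f (x, (2:ℝ) ^ j) * μ (x, (2:ℝ) ^ j) ∂σ else 0]
  refine ENNReal.tsum_le_tsum fun j => ?_
  simp only [Equiv.neg_apply]
  split_ifs with hj
  · rw [← lintegral_indicator (measurableSet_dyadicCube n k m)]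
    refine lintegral_mono fun x => ?_
    have hx := hle (x, (2:ℝ) ^ (-j))
    by_cases hxQ : x ∈ dyadicCube n k m
    · rw [indicator_of_mem hxQ]
      exact mul_le_mul_right (hx.trans (indicator_le_self _ _ _)) _
    · have h0 : h (x, (2:ℝ) ^ (-j)) = 0 := by
        simpa [boxFn, carlesonBox, hxQ] using hx
      rw [h0, mul_zero]
      exact zero_le
  · refine le_of_eq (lintegral_eq_zero_of_ae_eq_zero (Filter.Eventually.of_forall fun x => ?_))
    have h0 : h (x, (2:ℝ) ^ (-j)) = 0 := by
      have hx := hle (x, (2:ℝ) ^ (-j))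
      rw [boxFn, indicator_of_notMem (fun hmem => hj hmem.2.2)] at hx
      exact le_antisymm hx zero_le
    simp only [h0, mul_zero, Pi.zero_apply]

lemma ENNReal.rpow_sub_two_mul_self {a : ℝ≥0∞} (ha : a ≠ ∞) {q : ℝ} (hq : 1 < q) :
    a ^ (q - 2) * a = a ^ (q - 1) := by
  rcases eq_or_ne a 0 with rfl | h0
  · rw [mul_zero, ENNReal.zero_rpow_of_pos (by linarith)]
  · nth_rw 2 [← ENNReal.rpow_one a]
    rw [← ENNReal.rpow_add _ _ h0 ha]
    ring_nf

lemma ENNReal.rpow_sub_one_mul_self (a : ℝ≥0∞) {q : ℝ} (hq : 1 < q) :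
    a ^ (q - 1) * a = a ^ q := by
  nth_rw 2 [← ENNReal.rpow_one a]
  rw [← ENNReal.rpow_add_of_nonneg _ _ (by linarith) zero_le_one]
  ring_nf

/-- Duality for functions of finite norm: a bound on `f ↦ ∬_{Q̂} f μ` controls the dual norm of
every `h ≤ 1_{Q̂} μ` whose dual norm is finite. -/
lemma mixedNorm_le_of_boxInt_le {n : ℕ} {σ : Measure (Fin n → ℝ)} {p q : ℝ}
    (hpq : p.HolderConjugate q) {μ h : (Fin n → ℝ) × ℝ → ℝ≥0∞} (hh : Measurable h)
    {k : ℤ} {m : Fin n → ℤ} (hle : h ≤ boxFn n μ k m) {K : ℝ≥0∞}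
    (hK : ∀ f, Measurable f → boxInt n σ μ f k m ≤ K * mixedNorm n σ p f)
    (hfin : ∀ x, vertL2 n h x ≠ ∞) (hint : ∫⁻ x, vertL2 n h x ^ q ∂σ ≠ ∞) :
    mixedNorm n σ q h ≤ K := by
  have hq1 : 1 < q := hpq.symm.lt
  have hHm := measurable_vertL2 hh
  set f : (Fin n → ℝ) × ℝ → ℝ≥0∞ := fun z => vertL2 n h z.1 ^ (q - 2) * h z with hf
  have hfm : Measurable f := ((hHm.comp measurable_fst).pow_const _).mul hh
  have hvert : ∀ x, vertL2 n f x ^ p = vertL2 n h x ^ q := fun x => by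
    rw [hf, vertL2_mul n (fun x => vertL2 n h x ^ (q - 2)) h,
      ENNReal.rpow_sub_two_mul_self (hfin x) hq1, ← ENNReal.rpow_mul, hpq.symm.sub_one_mul_conj]
  have hpair : ∀ x, ∑' j : ℤ, f (x, (2:ℝ) ^ (-j)) * h (x, (2:ℝ) ^ (-j)) = vertL2 n h x ^ q :=
    fun x => by
      simp only [hf, mul_assoc, ENNReal.tsum_mul_left, ← pow_two]
      rw [← vertL2_sq, pow_two, ← mul_assoc, ENNReal.rpow_sub_two_mul_self (hfin x) hq1,
        ENNReal.rpow_sub_one_mul_self _ hq1]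
  have key := (lintegral_tsum_le_boxInt σ hfm hh hle).trans (hK f hfm)
  simp only [hpair, mixedNorm, hvert] at key
  rw [mixedNorm]
  set A := ∫⁻ x, vertL2 n h x ^ q ∂σ
  rcases eq_or_ne A 0 with hA | hA
  · rw [hA, ENNReal.zero_rpow_of_pos (by have := hpq.symm.pos; positivity)]
    exact zero_le
  · have hsplit : A = A ^ (1 / q) * A ^ (1 / p) := by
      rw [← ENNReal.rpow_add _ _ hA hint, one_div, one_div, hpq.symm.inv_add_inv_eq_one,
        ENNReal.rpow_one]
    nth_rw 1 [hsplit] at key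
    exact (ENNReal.mul_le_mul_iff_left (by simp [hA, hint]) (by simp [hA, hint])).1 key

/-- The truncations of `1_{Q̂} μ` to height at most `N` and scales at least `2^{-N}`. -/
def boxTrunc (n : ℕ) (μ : (Fin n → ℝ) × ℝ → ℝ≥0∞) (k : ℤ) (m : Fin n → ℤ) (N : ℕ) :
    (Fin n → ℝ) × ℝ → ℝ≥0∞ :=
  (dyadicCube n k m ×ˢ Set.Icc ((2:ℝ) ^ (-(N:ℤ))) ((2:ℝ) ^ (-k))).indicator
    fun z => min (μ z) N

lemma measurable_boxTrunc {n : ℕ} {μ : (Fin n → ℝ) × ℝ → ℝ≥0∞} (hμ : Measurable μ) (k : ℤ)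
    (m : Fin n → ℤ) (N : ℕ) : Measurable (boxTrunc n μ k m N) :=
  (hμ.min measurable_const).indicator ((measurableSet_dyadicCube n k m).prod measurableSet_Icc)

lemma boxTrunc_le_boxFn (n : ℕ) (μ : (Fin n → ℝ) × ℝ → ℝ≥0∞) (k : ℤ) (m : Fin n → ℤ) (N : ℕ) :
    boxTrunc n μ k m N ≤ boxFn n μ k m := by
  refine indicator_le' (fun z hz => ?_) fun _ _ => zero_le
  rw [boxFn, indicator_of_mem]
  · exact min_le_left _ _
  · exact ⟨hz.1, lt_of_lt_of_le (by positivity) hz.2.1, hz.2.2⟩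

lemma monotone_boxTrunc (n : ℕ) (μ : (Fin n → ℝ) × ℝ → ℝ≥0∞) (k : ℤ) (m : Fin n → ℤ) :
    Monotone (boxTrunc n μ k m) := by
  intro N M hNM
  refine indicator_le' (fun z hz => ?_) fun _ _ => zero_le
  rw [boxTrunc, indicator_of_mem]
  · exact min_le_min_left _ (by exact_mod_cast hNM)
  · refine ⟨hz.1, le_trans ?_ hz.2.1, hz.2.2⟩
    exact zpow_le_zpow_right₀ one_le_two (by omega)

lemma iSup_boxTrunc (n : ℕ) (μ : (Fin n → ℝ) × ℝ → ℝ≥0∞) (k : ℤ) (m : Fin n → ℤ)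
    (x : Fin n → ℝ) (j : ℤ) :
    ⨆ N, boxTrunc n μ k m N (x, (2:ℝ) ^ (-j)) = boxFn n μ k m (x, (2:ℝ) ^ (-j)) := by
  refine le_antisymm (iSup_le fun N => boxTrunc_le_boxFn n μ k m N _) ?_
  by_cases hz : (x, (2:ℝ) ^ (-j)) ∈ carlesonBox n k m
  · rw [boxFn, indicator_of_mem hz]
    refine le_of_forall_lt fun c hc => ?_
    obtain ⟨M, hM⟩ := ENNReal.exists_nat_gt hc.ne_top
    have hj : (j : ℤ) ≤ (max M j.toNat : ℕ) := by omega
    have hmem : (x, (2:ℝ) ^ (-j)) ∈ dyadicCube n k m ×ˢ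
        Set.Icc ((2:ℝ) ^ (-((max M j.toNat : ℕ) : ℤ))) ((2:ℝ) ^ (-k)) :=
      ⟨hz.1, zpow_le_zpow_right₀ one_le_two (neg_le_neg hj), hz.2.2⟩
    refine lt_of_lt_of_le ?_ (le_iSup _ (max M j.toNat))
    rw [boxTrunc, indicator_of_mem hmem]
    exact lt_min hc (hM.trans_le (by exact_mod_cast le_max_left _ _))
  · rw [boxFn, indicator_of_notMem hz]
    exact zero_le

lemma vertL2_boxTrunc_le (n : ℕ) (μ : (Fin n → ℝ) × ℝ → ℝ≥0∞) (k : ℤ) (m : Fin n → ℤ) (N : ℕ) :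
    ∃ B : ℝ≥0, ∀ x, vertL2 n (boxTrunc n μ k m N) x ≤
      (dyadicCube n k m).indicator (fun _ => (B : ℝ≥0∞)) x := by
  have hB : (∑ _j ∈ Finset.Icc k (N : ℤ), (N : ℝ≥0∞) ^ 2) ^ (1/2 : ℝ) ≠ ∞ :=
    ENNReal.rpow_ne_top_of_nonneg (by norm_num)
      (ENNReal.sum_ne_top.2 fun _ _ => ENNReal.pow_ne_top (ENNReal.natCast_ne_top N))
  refine ⟨((∑ _j ∈ Finset.Icc k (N : ℤ), (N : ℝ≥0∞) ^ 2) ^ (1/2 : ℝ)).toNNReal, fun x => ?_⟩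
  rw [ENNReal.coe_toNNReal hB]
  by_cases hx : x ∈ dyadicCube n k m
  · rw [indicator_of_mem hx, vertL2]
    refine ENNReal.rpow_le_rpow ?_ (by norm_num)
    rw [tsum_eq_sum (s := Finset.Icc k (N : ℤ)) fun j hj => ?_]
    · refine Finset.sum_le_sum fun j _ => ?_
      gcongr
      exact indicator_apply_le' (fun _ => min_le_right _ _) fun _ => zero_le
    · have hmem : (x, (2:ℝ) ^ (-j)) ∉ dyadicCube n k m ×ˢ
          Set.Icc ((2:ℝ) ^ (-(N:ℤ))) ((2:ℝ) ^ (-k)) := by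
        rintro ⟨-, h₁, h₂⟩
        refine hj (Finset.mem_Icc.2 ⟨?_, ?_⟩)
        · exact neg_le_neg_iff.1 ((zpow_le_zpow_iff_right₀ _root_.one_lt_two).1 h₂)
        · exact neg_le_neg_iff.1 ((zpow_le_zpow_iff_right₀ _root_.one_lt_two).1 h₁)
      rw [boxTrunc, indicator_of_notMem hmem, zero_pow two_ne_zero]
  · simp [vertL2, boxTrunc, hx]

lemma lintegral_vertL2_boxFn {n : ℕ} (σ : Measure (Fin n → ℝ)) {μ : (Fin n → ℝ) × ℝ → ℝ≥0∞}
    (hμ : Measurable μ) (k : ℤ) (m : Fin n → ℤ) {q : ℝ} (hq : 0 < q) :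
    ∫⁻ x, vertL2 n (boxFn n μ k m) x ^ q ∂σ =
      ⨆ N, ∫⁻ x, vertL2 n (boxTrunc n μ k m N) x ^ q ∂σ := by
  have hmono := monotone_boxTrunc n μ k m
  have hsq : ∀ x (j : ℤ), Monotone fun N => boxTrunc n μ k m N (x, (2:ℝ) ^ (-j)) ^ 2 :=
    fun x j N M hNM => pow_le_pow_left₀ zero_le (hmono hNM _) 2
  have hvmono : ∀ x, Monotone fun N => vertL2 n (boxTrunc n μ k m N) x := fun x N M hNM =>
    ENNReal.rpow_le_rpow (ENNReal.tsum_le_tsum fun j => hsq x j hNM) (by norm_num)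
  have hvert : ∀ x, vertL2 n (boxFn n μ k m) x = ⨆ N, vertL2 n (boxTrunc n μ k m N) x := by
    intro x
    have hhalf := (ENNReal.orderIsoRpow (1/2 : ℝ) (by norm_num)).map_iSup
      fun N => ∑' j : ℤ, boxTrunc n μ k m N (x, (2:ℝ) ^ (-j)) ^ 2
    simp only [ENNReal.orderIsoRpow_apply] at hhalf
    simp only [vertL2]
    rw [← hhalf]
    simp only [← iSup_boxTrunc, ENNReal.iSup_pow]
    congr 1
    simp only [← lintegral_count]
    exact lintegral_iSup (fun _ => measurable_of_countable _) fun N M hNM j => hsq x j hNM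
  have hpow : ∀ x, vertL2 n (boxFn n μ k m) x ^ q =
      ⨆ N, vertL2 n (boxTrunc n μ k m N) x ^ q := fun x => by
    rw [hvert]
    exact (ENNReal.orderIsoRpow q hq).map_iSup _
  simp only [hpow]
  exact lintegral_iSup
    (fun N => (measurable_vertL2 (measurable_boxTrunc hμ k m N)).pow_const q)
    fun N M hNM x => ENNReal.rpow_le_rpow (hvmono x hNM) hq.le

/-- If the bilinear form `Λ` is bounded, then `‖1_{Q̂}μ‖_{L^{p'}(σ;ℓ²)} < ∞` for every
dyadic cube `Q` with `λ_Q > 0`, `σ(Q) > 0` and `ω(Q) > 0`. -/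
theorem statement13 (p : ℝ) (hp : 1 < p) (n : ℕ) (hn : 0 < n)
    (σ ω : Measure (Fin n → ℝ)) [IsLocallyFiniteMeasure σ] [IsLocallyFiniteMeasure ω]
    (μ : (Fin n → ℝ) × ℝ → ℝ≥0∞) (hμ : Measurable μ) (lam : CubeIdx n → ℝ≥0)
    (C : ℝ≥0∞) (hC : C < ∞)
    (hbound : ∀ (f : (Fin n → ℝ) × ℝ → ℝ≥0∞) (g : (Fin n → ℝ) → ℝ≥0∞),
      Measurable f → Measurable g →
      lambdaForm n σ ω μ lam f g ≤ C * mixedNorm n σ p f * lpNorm n ω (p/(p-1)) g) :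
    ∀ Q : CubeIdx n, 0 < lam Q → 0 < σ (idxCube n Q) → 0 < ω (idxCube n Q) →
      mixedNorm n σ (p/(p-1)) (boxFn n μ Q.1 Q.2) < ∞ := by
  intro Q hlam _ hω
  set q := p / (p - 1) with hq
  have hpq : p.HolderConjugate q := Real.HolderConjugate.conjExponent hp
  have hq0 : 0 < q := hpq.symm.pos
  have hQω := measure_dyadicCube_lt_top n ω Q.1 Q.2
  have hc0 : (lam Q : ℝ≥0∞) * ω (idxCube n Q) ≠ 0 :=
    mul_ne_zero (by exact_mod_cast hlam.ne') hω.ne'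
  have hct : (lam Q : ℝ≥0∞) * ω (idxCube n Q) ≠ ∞ :=
    ENNReal.mul_ne_top ENNReal.coe_ne_top hQω.ne
  set g : (Fin n → ℝ) → ℝ≥0∞ := (idxCube n Q).indicator 1 with hg
  have hQm : MeasurableSet (idxCube n Q) := measurableSet_dyadicCube n Q.1 Q.2
  have hgm : Measurable g := measurable_one.indicator hQm
  have hgn : lpNorm n ω q g < ∞ := by
    have : ∀ x, g x ^ q = (idxCube n Q).indicator 1 x := fun x => by
      by_cases hx : x ∈ idxCube n Q <;> simp [hg, hx, hq0]
    simp only [_root_.lpNorm, this, lintegral_indicator_one hQm]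
    exact ENNReal.rpow_lt_top_of_nonneg (by positivity) hQω.ne
  set K := C * lpNorm n ω q g / (lam Q * ω (idxCube n Q)) with hKdef
  have hKt : K < ∞ := ENNReal.div_lt_top (ENNReal.mul_ne_top hC.ne hgn.ne) hc0
  have hK : ∀ f, Measurable f → boxInt n σ μ f Q.1 Q.2 ≤ K * mixedNorm n σ p f := by
    intro f hf
    have hterm := (ENNReal.le_tsum Q).trans (hbound f g hf hgm)
    have hgQ : ∫⁻ x in idxCube n Q, g x ∂ω = ω (idxCube n Q) := by
      rw [hg, lintegral_indicator_one hQm, Measure.restrict_apply hQm, inter_self]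
    rw [hgQ] at hterm
    rw [hKdef, ENNReal.mul_div_right_comm.symm, ENNReal.le_div_iff_mul_le (.inl hc0) (.inl hct)]
    calc _ = _ := by ring
      _ ≤ _ := hterm
      _ = _ := by ring
  refine lt_of_le_of_lt ?_ hKt
  rw [mixedNorm, lintegral_vertL2_boxFn σ hμ Q.1 Q.2 hq0, one_div, ENNReal.rpow_inv_le_iff hq0]
  refine iSup_le fun N => ?_
  rw [← ENNReal.rpow_inv_le_iff hq0, ← one_div]
  obtain ⟨B, hB⟩ := vertL2_boxTrunc_le n μ Q.1 Q.2 N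
  refine mixedNorm_le_of_boxInt_le hpq (measurable_boxTrunc hμ Q.1 Q.2 N)
    (boxTrunc_le_boxFn n μ Q.1 Q.2 N) hK (fun x => ?_) ?_
  · refine ne_top_of_le_ne_top ENNReal.coe_ne_top ((hB x).trans (indicator_le_self' ?_ x))
    exact fun _ _ => zero_le
  · refine ne_top_of_le_ne_top (b := ∫⁻ x, (dyadicCube n Q.1 Q.2).indicator
      (fun _ => (B : ℝ≥0∞) ^ q) x ∂σ) ?_ (lintegral_mono fun x => ?_)
    · rw [lintegral_indicator_const (measurableSet_dyadicCube n Q.1 Q.2)]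
      exact ENNReal.mul_ne_top (ENNReal.rpow_ne_top_of_nonneg hq0.le ENNReal.coe_ne_top)
        (measure_dyadicCube_lt_top n σ Q.1 Q.2).ne
    · refine (ENNReal.rpow_le_rpow (hB x) hq0.le).trans (le_of_eq ?_)
      by_cases hx : x ∈ dyadicCube n Q.1 Q.2 <;> simp [hx, hq0]

end
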